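/- Let m ≥ 1, b ≠ 0 a real number, and c_1,…,c_m real constants. For j = 1,…,m, let φ_j : ℝʲ → ℝ be (m-j+1) times continuously differentiable with φ_j(0) = 0. Define τ_0 := 0 and, recursively for j = 1,…,m, τ_j(x_1,…,x_j, Δ_0,…,Δ_{j-1}) := -c_j (b x_j − τ_{j-1}(x_1,…,x_{j-1}, Δ_0,…,Δ_{j-2}) − Δ_{j-1}) − b φ_j(x_1,…,x_j) + Σ_{k=1}^{j-1} [ (∂τ_{j-1}/∂x_k)·(x_{k+1} + φ_k(x_1,…,x_k)) + (∂τ_{j-1}/∂Δ_{k-1})·Δ_k ]. Let Δ : ℝ → ℝ be m times continuously differentiable and let X = (x_1,…,x_m) : ℝ → ℝᵐ be continuously differentiable satisfying ẋ_j(t) = x_{j+1}(t) + φ_j(x_1(t),…,x_j(t)) for j = 1,…,m-1 and ẋ_m(t) = φ_m(x_1(t),…,x_m(t)) + U(t), where the control law is U(t) = (1/b)[ τ_m(X(t), Δ(t),…,Δ^{(m-1)}(t)) + Δ^{(m)}(t) ]. Define r_j(t) := b x_j(t) − τ_{j-1}(x_1(t),…,x_{j-1}(t), Δ(t),…,Δ^{(j-2)}(t))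 − Δ^{(j-1)}(t) for j = 1,…,m. Then the r_j are differentiable and satisfy ṙ_j(t) = -c_j r_j(t) + r_{j+1}(t) for j = 1,…,m-1 and ṙ_m(t) = -c_m r_m(t). -/

import Mathlib

open Set Finset

/-- Extension of a finite vector to a sequence, by zero. -/
noncomputable def extendFin (m : ℕ) (x : Fin m → ℝ) : ℕ → ℝ :=
  fun j => if h : j < m then x ⟨j, h⟩ else 0

/-- The recursively defined predictor-based backstepping gain functions `τ_j`
(0-based data: `c j` is the paper's `c_{j+1}`, `φ j` is the paper's `φ_{j+1}`;
`τgain b c φ j` is the paper's `τ_j`). -/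
noncomputable def τgain (b : ℝ) (c : ℕ → ℝ) (φ : ℕ → (ℕ → ℝ) → ℝ) :
    ℕ → (ℕ → ℝ) → (ℕ → ℝ) → ℝ
  | 0 => fun _ _ => 0
  | (j + 1) => fun x Δ =>
      -(c j) * (b * x j - τgain b c φ j x Δ - Δ j) - b * φ j x
        + ∑ l ∈ Finset.range j,
            (deriv (fun a => τgain b c φ j (Function.update x l a) Δ) (x l)
                * (x (l + 1) + φ l x)
              + deriv (fun a => τgain b c φ j x (Function.update Δ l a)) (Δ l)
                * Δ (l + 1))

theorem extendFin_update {m : ℕ} (p : Fin m → ℝ) (i : Fin m) (a : ℝ) :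
    Function.update (extendFin m p) i a = extendFin m (Function.update p i a) := by
  ext k
  by_cases hk : k < m
  · by_cases hki : k = i
    · subst hki
      simp [extendFin]
    · have : (⟨k, hk⟩ : Fin m) ≠ i := fun h => hki (congrArg Fin.val h)
      simp [extendFin, hk, hki, this]
  · have hki : k ≠ i := fun h => hk (h ▸ i.isLt)
    simp [extendFin, hk, hki]

theorem extendFin_of_lt {m k : ℕ} (hk : k < m) (p : Fin m → ℝ) :
    extendFin m p k = p ⟨k, hk⟩ := by
  simp [extendFin, hk]

/-- `τ_j` depends only on the first `j` entries of both of its arguments. -/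
theorem τgain_congr {m : ℕ} {b : ℝ} {c : ℕ → ℝ} {φ : ℕ → (ℕ → ℝ) → ℝ}
    (hφdep : ∀ j < m, ∀ x x' : ℕ → ℝ, (∀ l ≤ j, x l = x' l) → φ j x = φ j x')
    {j : ℕ} (hj : j ≤ m) {x x' Δ Δ' : ℕ → ℝ}
    (hx : ∀ l < j, x l = x' l) (hΔ : ∀ l < j, Δ l = Δ' l) :
    τgain b c φ j x Δ = τgain b c φ j x' Δ' := by
  induction j generalizing x x' Δ Δ' with
  | zero => rfl
  | succ j ih =>
    have hupdate : ∀ {y y' : ℕ → ℝ}, (∀ l < j + 1, y l = y' l) → ∀ (i : ℕ) (a : ℝ),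
        ∀ l < j, Function.update y i a l = Function.update y' i a l := by
      intro y y' hy i a l hl
      by_cases hli : l = i
      · subst hli
        simp
      · simp [hli, hy l (by omega)]
    have hx' : ∀ l < j, x l = x' l := fun l hl => hx l (by omega)
    have hΔ' : ∀ l < j, Δ l = Δ' l := fun l hl => hΔ l (by omega)
    simp only [τgain]
    rw [ih (by omega) hx' hΔ', hx j (by omega), hΔ j (by omega),
      hφdep j (by omega) x x' fun l hl => hx l (by omega)]
    congr 1
    refine Finset.sum_congr rfl fun l hl => ?_
    have hl := Finset.mem_range.1 hl
    rw [hx l (by omega), hx (l + 1) (by omega), hΔ l (by omega), hΔ (l + 1) (by omega),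
      hφdep l (by omega) x x' fun k hk => hx k (by omega)]
    congr 3
    · ext a
      exact ih (by omega) (hupdate hx l a) hΔ'
    · ext a
      exact ih (by omega) hx' (hupdate hΔ l a)

theorem contDiff_comp_extendFin {m n k : ℕ} (hk : k < m) {f : (ℕ → ℝ) → ℝ}
    (hdep : ∀ x x' : ℕ → ℝ, (∀ l ≤ k, x l = x' l) → f x = f x')
    (hf : ContDiff ℝ (n : ℕ∞) fun x : Fin (k + 1) → ℝ => f (extendFin (k + 1) x)) :
    ContDiff ℝ (n : ℕ∞) fun x : Fin m → ℝ => f (extendFin m x) := by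
  have hres : ContDiff ℝ (n : ℕ∞)
      fun (x : Fin m → ℝ) (i : Fin (k + 1)) => x (Fin.castLE hk i) := by
    fun_prop
  convert hf.comp hres using 2 with x
  refine hdep _ _ fun l hl => ?_
  rw [extendFin_of_lt (by omega), extendFin_of_lt (by omega)]
  rfl

section Partial

variable {m : ℕ} {g : (ℕ → ℝ) → (ℕ → ℝ) → ℝ} {p : (Fin m → ℝ) × (Fin m → ℝ)}

theorem deriv_update_left_eq_fderiv
    (hg : DifferentiableAt ℝ
      (fun q : (Fin m → ℝ) × (Fin m → ℝ) => g (extendFin m q.1) (extendFin m q.2)) p)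
    (i : Fin m) :
    deriv (fun a => g (Function.update (extendFin m p.1) i a) (extendFin m p.2))
        (extendFin m p.1 i) =
      fderiv ℝ (fun q : (Fin m → ℝ) × (Fin m → ℝ) => g (extendFin m q.1) (extendFin m q.2)) p
        (Pi.single i 1, 0) := by
  simp only [extendFin_update, extendFin_of_lt i.isLt]
  have hline : HasDerivAt (fun a => (Function.update p.1 i a, p.2)) (Pi.single i (1 : ℝ), 0)
      (p.1 i) := (hasDerivAt_update p.1 i (p.1 i)).prodMk (hasDerivAt_const _ _)
  refine (HasFDerivAt.comp_hasDerivAt_of_eq (p.1 i) hg.hasFDerivAt hline ?_).deriv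
  simp

theorem deriv_update_right_eq_fderiv
    (hg : DifferentiableAt ℝ
      (fun q : (Fin m → ℝ) × (Fin m → ℝ) => g (extendFin m q.1) (extendFin m q.2)) p)
    (i : Fin m) :
    deriv (fun a => g (extendFin m p.1) (Function.update (extendFin m p.2) i a))
        (extendFin m p.2 i) =
      fderiv ℝ (fun q : (Fin m → ℝ) × (Fin m → ℝ) => g (extendFin m q.1) (extendFin m q.2)) p
        (0, Pi.single i 1) := by
  simp only [extendFin_update, extendFin_of_lt i.isLt]
  have hline : HasDerivAt (fun a => (p.1, Function.update p.2 i a)) (0, Pi.single i (1 : ℝ))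
      (p.2 i) := (hasDerivAt_const _ _).prodMk (hasDerivAt_update p.2 i (p.2 i))
  refine (HasFDerivAt.comp_hasDerivAt_of_eq (p.2 i) hg.hasFDerivAt hline ?_).deriv
  simp

end Partial

/-- `τ_j`, as a function of finitely many variables, is `m - j` times continuously
differentiable. -/
theorem contDiff_τgain {m : ℕ} (b : ℝ) (c : ℕ → ℝ) {φ : ℕ → (ℕ → ℝ) → ℝ}
    (hφdep : ∀ j < m, ∀ x x' : ℕ → ℝ, (∀ l ≤ j, x l = x' l) → φ j x = φ j x')
    (hφsmooth : ∀ j < m, ContDiff ℝ ((m - j : ℕ) : ℕ∞)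
      (fun x : Fin (j + 1) → ℝ => φ j (extendFin (j + 1) x)))
    {j : ℕ} (hj : j ≤ m) :
    ContDiff ℝ ((m - j : ℕ) : ℕ∞) fun p : (Fin m → ℝ) × (Fin m → ℝ) =>
      τgain b c φ j (extendFin m p.1) (extendFin m p.2) := by
  induction j with
  | zero => exact contDiff_const
  | succ j ih =>
    obtain ⟨n, hn⟩ : ∃ n, m - j = n + 1 := ⟨m - j - 1, by omega⟩
    have hn' : m - (j + 1) = n := by omega
    rw [hn']
    have ihj := ih (by omega)
    rw [hn] at ihj
    have hτ : ContDiff ℝ (n : ℕ∞) fun p : (Fin m → ℝ) × (Fin m → ℝ) =>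
        τgain b c φ j (extendFin m p.1) (extendFin m p.2) :=
      ihj.of_le (by exact_mod_cast Nat.le_succ n)
    have hfderiv : ContDiff ℝ (n : ℕ∞) (fderiv ℝ fun p : (Fin m → ℝ) × (Fin m → ℝ) =>
        τgain b c φ j (extendFin m p.1) (extendFin m p.2)) :=
      ihj.fderiv_right (by norm_cast)
    have hdiff : Differentiable ℝ fun p : (Fin m → ℝ) × (Fin m → ℝ) =>
        τgain b c φ j (extendFin m p.1) (extendFin m p.2) :=
      ihj.differentiable (by norm_cast)
    have hφ : ∀ k ≤ j, ContDiff ℝ (n : ℕ∞) fun p : (Fin m → ℝ) × (Fin m → ℝ) =>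
        φ k (extendFin m p.1) := fun k hk =>
      (contDiff_comp_extendFin (by omega) (hφdep k (by omega))
        ((hφsmooth k (by omega)).of_le (by norm_cast; omega))).comp contDiff_fst
    have hfst : ∀ k ≤ j, ContDiff ℝ (n : ℕ∞) fun p : (Fin m → ℝ) × (Fin m → ℝ) =>
        extendFin m p.1 k := fun k hk => by
      simp only [extendFin_of_lt (show k < m by omega)]
      fun_prop
    have hsnd : ∀ k ≤ j, ContDiff ℝ (n : ℕ∞) fun p : (Fin m → ℝ) × (Fin m → ℝ) =>
        extendFin m p.2 k := fun k hk => by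
      simp only [extendFin_of_lt (show k < m by omega)]
      fun_prop
    simp only [τgain]
    refine ContDiff.add (((contDiff_const.mul (((contDiff_const.mul (hfst j le_rfl)).sub hτ).sub
      (hsnd j le_rfl)))).sub (contDiff_const.mul (hφ j le_rfl))) (ContDiff.sum fun l hl => ?_)
    have hl := Finset.mem_range.1 hl
    refine ContDiff.add (ContDiff.mul ?_ ((hfst (l + 1) (by omega)).add (hφ l (by omega))))
      (ContDiff.mul ?_ (hsnd (l + 1) (by omega)))
    · have hpartial := fun p => deriv_update_left_eq_fderiv (hdiff p) ⟨l, by omega⟩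
      simp only at hpartial
      simp only [hpartial]
      exact hfderiv.clm_apply contDiff_const
    · have hpartial := fun p => deriv_update_right_eq_fderiv (hdiff p) ⟨l, by omega⟩
      simp only at hpartial
      simp only [hpartial]
      exact hfderiv.clm_apply contDiff_const

/-- Chain rule for `τ_j` along a differentiable curve. -/
theorem hasDerivAt_τgain {m : ℕ} (b : ℝ) (c : ℕ → ℝ) {φ : ℕ → (ℕ → ℝ) → ℝ}
    (hφdep : ∀ j < m, ∀ x x' : ℕ → ℝ, (∀ l ≤ j, x l = x' l) → φ j x = φ j x')
    (hφsmooth : ∀ j < m, ContDiff ℝ ((m - j : ℕ) : ℕ∞)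
      (fun x : Fin (j + 1) → ℝ => φ j (extendFin (j + 1) x)))
    {j : ℕ} (hj : j < m) {x Δ : ℕ → ℝ → ℝ} {v w : ℕ → ℝ} {t : ℝ}
    (hx : ∀ l < j, HasDerivAt (x l) (v l) t) (hΔ : ∀ l < j, HasDerivAt (Δ l) (w l) t) :
    HasDerivAt (fun s => τgain b c φ j (fun l => x l s) (fun l => Δ l s))
      (∑ l ∈ Finset.range j,
        (deriv (fun a => τgain b c φ j (Function.update (fun l => x l t) l a)
            (fun l => Δ l t)) (x l t) * v l
          + deriv (fun a => τgain b c φ j (fun l => x l t)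
            (Function.update (fun l => Δ l t) l a)) (Δ l t) * w l)) t := by
  -- Freezing the irrelevant coordinates at zero makes the curve finite dimensional.
  let trunc (y : ℕ → ℝ) (i : Fin m) : ℝ := if (i : ℕ) < j then y i else 0
  have htrunc : ∀ (y : ℕ → ℝ), ∀ l < j, y l = extendFin m (trunc y) l := fun y l hl => by
    rw [extendFin_of_lt (by omega)]
    simp [trunc, hl]
  have htrunc_deriv : ∀ {y : ℕ → ℝ → ℝ} {u : ℕ → ℝ}, (∀ l < j, HasDerivAt (y l) (u l) t) →
      HasDerivAt (fun s => trunc fun l => y l s) (trunc u) t := fun {y u} hy => by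
    refine hasDerivAt_pi.2 fun i => ?_
    by_cases hi : (i : ℕ) < j
    · simpa [trunc, hi] using hy i hi
    · simpa [trunc, hi] using hasDerivAt_const t (0 : ℝ)
  have htrunc_sum : ∀ y : ℕ → ℝ,
      trunc y = ∑ l : Fin j, y l • Pi.single (Fin.castLE hj.le l) (1 : ℝ) := fun y => by
    ext i
    rw [Finset.sum_apply]
    by_cases hi : (i : ℕ) < j
    · rw [Finset.sum_eq_single ⟨i, hi⟩]
      · simp [trunc, hi]
      · intro l _ hl
        have : i ≠ Fin.castLE hj.le l := fun h => hl (Fin.ext (by simp [h]))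
        simp [this]
      · simp
    · simp only [trunc, hi, if_false]
      refine (Finset.sum_eq_zero fun l _ => ?_).symm
      have : i ≠ Fin.castLE hj.le l := fun h => hi (by simp [h])
      simp [this]
  have htrunc_update : ∀ (y : ℕ → ℝ) (k : ℕ) (a : ℝ), ∀ l < j,
      Function.update y k a l = Function.update (extendFin m (trunc y)) k a l := by
    intro y k a l hl
    by_cases hlk : l = k
    · subst hlk
      simp
    · simp [hlk, htrunc y l hl]
  let F := fun q : (Fin m → ℝ) × (Fin m → ℝ) =>
    τgain b c φ j (extendFin m q.1) (extendFin m q.2)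
  set p := (trunc (fun l => x l t), trunc (fun l => Δ l t)) with hp
  have hdiff : DifferentiableAt ℝ F p :=
    (contDiff_τgain b c hφdep hφsmooth hj.le).differentiable
      (by norm_cast; omega) p
  have hcurve : HasDerivAt (fun s => F (trunc (fun l => x l s), trunc (fun l => Δ l s)))
      (fderiv ℝ F p (trunc v, trunc w)) t :=
    HasFDerivAt.comp_hasDerivAt_of_eq t hdiff.hasFDerivAt
      ((htrunc_deriv hx).prodMk (htrunc_deriv hΔ)) rfl
  have hfun : (fun s => τgain b c φ j (fun l => x l s) (fun l => Δ l s)) =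
      fun s => F (trunc (fun l => x l s), trunc (fun l => Δ l s)) := by
    ext s
    exact τgain_congr hφdep hj.le (htrunc _) (htrunc _)
  rw [hfun]
  convert hcurve using 1
  have hsplit : (trunc v, trunc w) =
      ∑ l : Fin j, (v l • ((Pi.single (Fin.castLE hj.le l) (1 : ℝ), 0) :
          (Fin m → ℝ) × (Fin m → ℝ))
        + w l • ((0, Pi.single (Fin.castLE hj.le l) (1 : ℝ)) :
          (Fin m → ℝ) × (Fin m → ℝ))) := by
    rw [htrunc_sum v, htrunc_sum w]
    ext1 <;> simp [Prod.fst_sum, Prod.snd_sum]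
  rw [hsplit, map_sum, Finset.sum_range]
  refine Finset.sum_congr rfl fun l _ => ?_
  rw [map_add, map_smul, map_smul, ← deriv_update_left_eq_fderiv hdiff,
    ← deriv_update_right_eq_fderiv hdiff, smul_eq_mul, smul_eq_mul, mul_comm (v l),
    mul_comm (w l)]
  simp only [Fin.val_castLE, hp, ← htrunc _ l l.isLt]
  congr 3
  · ext a
    exact τgain_congr hφdep hj.le (htrunc_update _ _ _) (htrunc _)
  · ext a
    exact τgain_congr hφdep hj.le (htrunc _) (htrunc_update _ _ _)

/-- Section 3.2: under the nominal control law
`U(t) = (1/b)(τ_m(X(t), Δ,…,Δ^{(m-1)}) + Δ^{(m)}(t))`, the predictor-based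
nonundershooting backstepping transformation
`r_j = b x_j − τ_{j-1}(x, Δ,…,Δ^{(j-2)}) − Δ^{(j-1)}` maps the strict-feedback
actuator `ẋ_j = x_{j+1} + φ_j`, `ẋ_m = φ_m + U` into the exponentially stable
cascade `ṙ_j = -c_j r_j + r_{j+1}`, `ṙ_m = -c_m r_m`. (Indices 0-based.) -/
theorem stmt_10 (m : ℕ) (hm : 1 ≤ m) (b : ℝ) (hb : b ≠ 0) (c : ℕ → ℝ)
    (φ : ℕ → (ℕ → ℝ) → ℝ)
    (hφdep : ∀ j < m, ∀ x x' : ℕ → ℝ, (∀ l ≤ j, x l = x' l) → φ j x = φ j x')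
    (hφsmooth : ∀ j < m, ContDiff ℝ ((m - j : ℕ) : ℕ∞)
      (fun x : Fin (j + 1) → ℝ => φ j (extendFin (j + 1) x)))
    (hφ0 : ∀ j < m, φ j 0 = 0)
    (Δ : ℝ → ℝ) (hΔ : ContDiff ℝ (m : ℕ∞) Δ)
    (x : ℕ → ℝ → ℝ)
    (U : ℝ → ℝ)
    (hU : ∀ t, U t = (1 / b) *
      (τgain b c φ m (fun j => x j t) (fun j => iteratedDeriv j Δ t)
        + iteratedDeriv m Δ t))
    (hode : ∀ j, j + 1 < m → ∀ t : ℝ,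
      HasDerivAt (x j) (x (j + 1) t + φ j (fun l => x l t)) t)
    (hodem : ∀ t : ℝ,
      HasDerivAt (x (m - 1)) (φ (m - 1) (fun l => x l t) + U t) t)
    (r : ℕ → ℝ → ℝ)
    (hr : ∀ j t, r j t = b * x j t
      - τgain b c φ j (fun l => x l t) (fun l => iteratedDeriv l Δ t)
      - iteratedDeriv j Δ t) :
    (∀ j, j + 1 < m → ∀ t : ℝ,
      HasDerivAt (r j) (-(c j) * r j t + r (j + 1) t) t) ∧
    (∀ t : ℝ, HasDerivAt (r (m - 1)) (-(c (m - 1)) * r (m - 1) t) t) := by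
  have hΔderiv : ∀ l < m, ∀ t, HasDerivAt (iteratedDeriv l Δ) (iteratedDeriv (l + 1) Δ t) t := by
    intro l hl t
    rw [iteratedDeriv_succ]
    exact (hΔ.differentiable_iteratedDeriv l (by exact_mod_cast hl) t).hasDerivAt
  have hrderiv : ∀ j < m, ∀ (u t : ℝ), HasDerivAt (x j) (φ j (fun l => x l t) + u) t →
      HasDerivAt (r j) (-(c j) * r j t + (b * u
        - τgain b c φ (j + 1) (fun l => x l t) (fun l => iteratedDeriv l Δ t)
        - iteratedDeriv (j + 1) Δ t)) t := by
    intro j hj u t hxj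
    have hτ := hasDerivAt_τgain b c hφdep hφsmooth hj
      (fun l hl => hode l (by omega) t) (fun l hl => hΔderiv l (by omega) t)
    rw [funext (hr j)]
    refine (((hxj.const_mul b).sub hτ).sub (hΔderiv j hj t)).congr_deriv ?_
    simp only [τgain]
    ring
  refine ⟨fun j hj t => ?_, fun t => ?_⟩
  · rw [hr (j + 1)]
    exact hrderiv j (by omega) _ t (by simpa only [add_comm] using hode j hj t)
  · refine (hrderiv (m - 1) (by omega) (U t) t (hodem t)).congr_deriv ?_
    rw [Nat.sub_add_cancel hm, hU]
    field_simp
    ring
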